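/- Every nonzero linear subspace W of 𝒱 that is invariant under all the operators E_i (1 ≤ i ≤ n) contains a nonzero primitive vector, i.e. a nonzero v ∈ W with E_i v = 0 for all i = 1,…,n. -/

import Mathlib

noncomputable section

/-- The index set `M` of tuples `m = (m_{jk})_{1 ≤ j ≤ k ≤ n}` with entries in `ℤ/lℤ`. -/
abbrev Mt (l n : ℕ) := {p : ℕ × ℕ // 1 ≤ p.1 ∧ p.1 ≤ p.2 ∧ p.2 ≤ n} → ZMod l

/-- The vector space `𝒱` with basis `(u_m)_{m ∈ M}`. -/
abbrev Vsp (l n : ℕ) := Mt l n →₀ ℂ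

/-- The basis vector `u_m` of `𝒱`. -/
def um {l n : ℕ} (m : Mt l n) : Vsp l n := Finsupp.single m 1

/-- The tuple `δ_{jk}` with `(j,k)`-entry `1` and all other entries `0`
(it is `0` if `(j,k)` is out of range). -/
def dlt {l n : ℕ} (j k : ℕ) : Mt l n := fun p => if p.val = (j, k) then 1 else 0

/-- The `(j,k)`-entry of `m`, read as `0` outside the range `1 ≤ j ≤ k ≤ n`. -/
def mval {l n : ℕ} (m : Mt l n) (j k : ℕ) : ZMod l :=
  if h : 1 ≤ j ∧ j ≤ k ∧ k ≤ n then m ⟨(j, k), h⟩ else 0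

/-- The shift operator `u_m ↦ u_{m + ξ}` on `𝒱`. -/
def shiftOp {l n : ℕ} (ξ : Mt l n) : Module.End ℂ (Vsp l n) :=
  Finsupp.lmapDomain ℂ ℂ (fun m => m + ξ)

/-- The diagonal operator `u_m ↦ f(m) • u_m` on `𝒱`. -/
def diagOp {l n : ℕ} (f : Mt l n → ℂ) : Module.End ℂ (Vsp l n) :=
  Finsupp.lsum ℂ (fun m => f m • Finsupp.lsingle m)

/-- `ε^a` for `a ∈ ℤ/lℤ`, well defined via the canonical representative since `ε^l = 1`. -/
def epow {l : ℕ} (ε : ℂ) (a : ZMod l) : ℂ := ε ^ a.val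

/-- The operator `X_{jk} : u_m ↦ ε^{m_{jk}} u_m` (the identity for out-of-range `(j,k)`). -/
def Xop (l n : ℕ) (ε : ℂ) (j k : ℕ) : Module.End ℂ (Vsp l n) :=
  diagOp (fun m => epow ε (mval m j k))

/-- The inverse operator `X_{jk}⁻¹ : u_m ↦ ε^{-m_{jk}} u_m`. -/
def XopInv (l n : ℕ) (ε : ℂ) (j k : ℕ) : Module.End ℂ (Vsp l n) :=
  diagOp (fun m => (epow ε (mval m j k))⁻¹)

/-- `{c W} = (cW - c⁻¹W⁻¹)/(ε - ε⁻¹)` for the invertible shift operator `W = shiftOp ζ`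
(whose inverse is `shiftOp (-ζ)`). -/
def braceShift (l n : ℕ) (ε c : ℂ) (ζ : Mt l n) : Module.End ℂ (Vsp l n) :=
  (ε - ε⁻¹)⁻¹ • (c • shiftOp ζ - c⁻¹ • shiftOp (-ζ))

/-- The total shift of `Z_{ik} Z_{i,k-1} Z_{i-1,k-1}⁻¹ Z_{i+1,k}⁻¹`. -/
def zetaE (l n : ℕ) (i k : ℕ) : Mt l n :=
  dlt i k + dlt i (k - 1) - dlt (i - 1) (k - 1) - dlt (i + 1) k

/-- The total shift of
`Z_{i+1-k,n-k} Z_{i+1-k,n+1-k}⁻¹ Z_{i-k,n+1-k} Z_{i-k,n-k}⁻¹`. -/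
def zetaF (l n : ℕ) (i k : ℕ) : Mt l n :=
  dlt (i + 1 - k) (n - k) - dlt (i + 1 - k) (n + 1 - k) +
    dlt (i - k) (n + 1 - k) - dlt (i - k) (n - k)

/-- The total shift of `Z_{in}² Z_{i-1,n}⁻¹ Z_{i+1,n}⁻¹`. -/
def zetaT (l n : ℕ) (i : ℕ) : Mt l n :=
  dlt i n + dlt i n - dlt (i - 1) n - dlt (i + 1) n

/-- The product `X_{ik} X_{i,k+1} ⋯ X_{in}`. -/
def XprodE (l n : ℕ) (ε : ℂ) (i k : ℕ) : Module.End ℂ (Vsp l n) :=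
  (List.ofFn (fun t : Fin (n + 1 - k) => Xop l n ε i (k + (t : ℕ)))).prod

/-- The product `X_{i+1-k,n+1-k}⁻¹ X_{i+2-k,n+2-k}⁻¹ ⋯ X_{i,n}⁻¹`. -/
def XprodF (l n : ℕ) (ε : ℂ) (i k : ℕ) : Module.End ℂ (Vsp l n) :=
  (List.ofFn (fun t : Fin k =>
    XopInv l n ε (i + 1 - k + (t : ℕ)) (n + 1 - k + (t : ℕ)))).prod

/-- The representation operator `Φ_{r,s,a,b}(e_i)`. -/
def PhiE (l n : ℕ) (ε : ℂ) (r : ℕ → ℂ) (a b : ℕ → ℕ → ℂ) (i : ℕ) :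
    Module.End ℂ (Vsp l n) :=
  ∑ k ∈ Finset.Icc i n,
    (∏ t ∈ Finset.range (n + 1 - k), a i (k + t)) •
      (XprodE l n ε i k *
        braceShift l n ε
          (r i * (b i k * b i (k - 1) * (b (i - 1) (k - 1))⁻¹ * (b (i + 1) k)⁻¹))
          (zetaE l n i k))

/-- The representation operator `Φ_{r,s,a,b}(f_i)`. -/
def PhiF (l n : ℕ) (ε : ℂ) (s : ℕ → ℂ) (a b : ℕ → ℕ → ℂ) (i : ℕ) :
    Module.End ℂ (Vsp l n) :=
  ∑ k ∈ Finset.Icc 1 i,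
    (∏ t ∈ Finset.range k, a (i + 1 - k + t) (n + 1 - k + t))⁻¹ •
      (XprodF l n ε i k *
        braceShift l n ε
          (s i * (b (i + 1 - k) (n - k) * (b (i + 1 - k) (n + 1 - k))⁻¹ *
            b (i - k) (n + 1 - k) * (b (i - k) (n - k))⁻¹))
          (zetaF l n i k))

/-- The representation operator `Φ_{r,s,a,b}(t_i)`. -/
def PhiT (l n : ℕ) (ε : ℂ) (r s : ℕ → ℂ) (b : ℕ → ℕ → ℂ) (i : ℕ) :
    Module.End ℂ (Vsp l n) :=
  ((r i / s i) * (b i n ^ 2 * (b (i - 1) n)⁻¹ * (b (i + 1) n)⁻¹)) • shiftOp (zetaT l n i)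

/-- The specialized operator `E_i = Σ_{k=i}^n X_{ik}⋯X_{in} {Z_{ik}Z_{i,k-1}Z_{i-1,k-1}⁻¹Z_{i+1,k}⁻¹}`. -/
def Esp (l n : ℕ) (ε : ℂ) (i : ℕ) : Module.End ℂ (Vsp l n) :=
  ∑ k ∈ Finset.Icc i n, XprodE l n ε i k * braceShift l n ε 1 (zetaE l n i k)

/-- The specialized operator
`F_i = Σ_{k=1}^i X_{i+1-k,n+1-k}⁻¹⋯X_{i,n}⁻¹ {ε^{-λ_i} Z_{i+1-k,n-k}Z_{i+1-k,n+1-k}⁻¹Z_{i-k,n+1-k}Z_{i-k,n-k}⁻¹}`. -/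
def Fsp (l n : ℕ) (ε : ℂ) (lam : ℕ → ℕ) (i : ℕ) : Module.End ℂ (Vsp l n) :=
  ∑ k ∈ Finset.Icc 1 i, XprodF l n ε i k * braceShift l n ε ((ε ^ lam i)⁻¹) (zetaF l n i k)

/-- The specialized operator `T_i = ε^{λ_i} Z_{in}² Z_{i-1,n}⁻¹ Z_{i+1,n}⁻¹`. -/
def Tsp (l n : ℕ) (ε : ℂ) (lam : ℕ → ℕ) (i : ℕ) : Module.End ℂ (Vsp l n) :=
  (ε ^ lam i) • shiftOp (zetaT l n i)

/-- The inverse operator `T_i⁻¹`. -/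
def TspInv (l n : ℕ) (ε : ℂ) (lam : ℕ → ℕ) (i : ℕ) : Module.End ℂ (Vsp l n) :=
  (ε ^ lam i)⁻¹ • shiftOp (-(zetaT l n i))

/-- The smallest exponent `i` with `ε ^ i = z`. -/
def dlog (ε z : ℂ) : ℕ := sInf {i | ε ^ i = z}

section DiscreteLog

variable {l : ℕ} {ε : ℂ}

theorem epow_zero : epow ε (0 : ZMod l) = 1 := by simp [epow]

theorem epow_one (hl : 1 < l) : epow ε (1 : ZMod l) = ε := by
  rw [epow, ZMod.val_one'' (by omega), pow_one]

variable [NeZero l]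

theorem pow_dlog (hε : IsPrimitiveRoot ε l) {z : ℂ} (hz : z ^ l = 1) : ε ^ dlog ε z = z := by
  obtain ⟨i, -, hi⟩ := hε.eq_pow_of_pow_eq_one hz
  exact Nat.sInf_mem (s := {i | ε ^ i = z}) ⟨i, hi⟩

theorem dlog_lt (hε : IsPrimitiveRoot ε l) {z : ℂ} (hz : z ^ l = 1) : dlog ε z < l := by
  obtain ⟨i, hil, hi⟩ := hε.eq_pow_of_pow_eq_one hz
  exact (Nat.sInf_le (s := {i | ε ^ i = z}) hi).trans_lt hil

theorem dlog_mul_inv_lt (hε : IsPrimitiveRoot ε l) {z : ℂ} (hz : z ^ l = 1) (hz1 : z ≠ 1) :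
    dlog ε (z * ε⁻¹) < dlog ε z := by
  have hpow := pow_dlog hε hz
  have hpos : dlog ε z ≠ 0 := fun h => hz1 (by rw [← hpow, h, pow_zero])
  obtain ⟨a, ha⟩ := Nat.exists_eq_succ_of_ne_zero hpos
  have hε0 : ε ≠ 0 := hε.ne_zero (NeZero.ne l)
  have h : ε ^ a = z * ε⁻¹ := by
    rw [← hpow, ha, pow_succ, mul_inv_cancel_right₀ hε0]
  have := Nat.sInf_le (s := {i | ε ^ i = z * ε⁻¹}) h
  rw [ha]
  exact Nat.lt_succ_of_le this

theorem epow_add (hε : IsPrimitiveRoot ε l) (a b : ZMod l) :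
    epow ε (a + b) = epow ε a * epow ε b := by
  rw [epow, epow, epow, ZMod.val_add, ← pow_add, ← pow_eq_pow_mod _ hε.pow_eq_one]

end DiscreteLog

/-- Lexicographic comparison of digit expansions in base `l`. -/
theorem sum_digits_lt {l : ℕ} {d d' : ℕ → ℕ} (hd' : ∀ j, d' j < l) {P : ℕ} (hP : d' P < d P)
    (heq : ∀ j, P < j → d' j = d j) {N : ℕ} (hN : P < N) :
    ∑ j ∈ Finset.range N, d' j * l ^ j < ∑ j ∈ Finset.range N, d j * l ^ j := by
  have hbound : ∀ N, ∑ j ∈ Finset.range N, d' j * l ^ j < l ^ N := by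
    intro N
    induction N with
    | zero => simp
    | succ N ih =>
      rw [Finset.sum_range_succ, pow_succ]
      nlinarith [Nat.mul_le_mul_right (l ^ N) (hd' N)]
  induction N, hN using Nat.le_induction with
  | base =>
    rw [Finset.sum_range_succ, Finset.sum_range_succ]
    have := Nat.mul_le_mul_right (l ^ P) (Nat.succ_le_of_lt hP)
    rw [Nat.succ_mul] at this
    have := hbound P
    omega
  | succ N hN ih =>
    rw [Finset.sum_range_succ, Finset.sum_range_succ, heq N hN]
    omega

section Fourier

variable {l n : ℕ}

instance finiteIndex (n : ℕ) : Finite {p : ℕ × ℕ // 1 ≤ p.1 ∧ p.1 ≤ p.2 ∧ p.2 ≤ n} :=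
  Set.Finite.to_subtype (s := {p : ℕ × ℕ | 1 ≤ p.1 ∧ p.1 ≤ p.2 ∧ p.2 ≤ n})
    ((Set.finite_Iic (n, n)).subset fun _ hp => ⟨hp.2.1.trans hp.2.2, hp.2.2⟩)

theorem diagOp_apply (f : Mt l n → ℂ) (v : Vsp l n) (m : Mt l n) :
    diagOp f v m = f m * v m := by
  induction v using Finsupp.induction_linear with
  | zero => simp
  | add v w hv hw => rw [map_add, Finsupp.add_apply, hv, hw, Finsupp.add_apply, mul_add]
  | single a b =>
    by_cases h : a = m <;> simp [diagOp, h]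

theorem shiftOp_apply (ξ : Mt l n) (v : Vsp l n) (m : Mt l n) :
    shiftOp ξ v m = v (m - ξ) := by
  conv_lhs => rw [← sub_add_cancel m ξ]
  exact Finsupp.mapDomain_apply (add_left_injective ξ) v (m - ξ)

theorem apply_pow_eq_one (ψ : AddChar (Mt l n) ℂ) (ξ : Mt l n) : ψ ξ ^ l = 1 := by
  have h : l • ξ = 0 := by ext p; simp
  rw [← AddChar.map_nsmul_eq_pow, h, AddChar.map_zero_eq_one]

variable [NeZero l]

/-- The joint eigenvector `∑ ψ(-m) u_m` of the shift operators attached to a character `ψ`. -/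
def waveVec (ψ : AddChar (Mt l n) ℂ) : Vsp l n :=
  Finsupp.equivFunOnFinite.symm fun m => ψ (-m)

theorem waveVec_apply (ψ : AddChar (Mt l n) ℂ) (m : Mt l n) : waveVec ψ m = ψ (-m) := rfl

theorem shiftOp_waveVec (ξ : Mt l n) (ψ : AddChar (Mt l n) ℂ) :
    shiftOp ξ (waveVec ψ) = ψ ξ • waveVec ψ := by
  ext m
  rw [shiftOp_apply, Finsupp.smul_apply, waveVec_apply, waveVec_apply, neg_sub, sub_eq_add_neg,
    AddChar.map_add_eq_mul, smul_eq_mul]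

theorem diagOp_waveVec (χ ψ : AddChar (Mt l n) ℂ) :
    diagOp χ (waveVec ψ) = waveVec (ψ * χ⁻¹) := by
  ext m
  rw [diagOp_apply, waveVec_apply, waveVec_apply, AddChar.mul_apply, AddChar.inv_apply, neg_neg,
    mul_comm]

theorem list_prod_diagOp_waveVec (L : List (AddChar (Mt l n) ℂ)) (ψ : AddChar (Mt l n) ℂ) :
    (L.map fun χ : AddChar (Mt l n) ℂ => diagOp χ).prod (waveVec ψ) = waveVec (ψ * L.prod⁻¹) := by
  induction L with
  | nil => simp
  | cons χ L ih =>
    rw [List.map_cons, List.prod_cons, Module.End.mul_apply, ih, diagOp_waveVec, List.prod_cons,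
      mul_inv, mul_assoc, mul_comm L.prod⁻¹]

theorem span_waveVec : Submodule.span ℂ (Set.range (waveVec (l := l) (n := n))) = ⊤ := by
  classical
  have := Fintype.ofFinite (Mt l n)
  rw [eq_top_iff]
  intro v _
  induction v using Finsupp.induction_linear with
  | zero => exact zero_mem _
  | add v w hv hw => exact add_mem (hv trivial) (hw trivial)
  | single a b =>
    have h : Finsupp.single a b = ∑ ψ : AddChar (Mt l n) ℂ,
        (b * (Fintype.card (Mt l n) : ℂ)⁻¹ * ψ a) • waveVec ψ := by
      ext m
      have hcard : (Fintype.card (Mt l n) : ℂ) ≠ 0 := Nat.cast_ne_zero.2 Fintype.card_ne_zero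
      simp only [Finsupp.finsetSum_apply, Finsupp.smul_apply, smul_eq_mul, waveVec_apply,
        mul_assoc, ← AddChar.map_add_eq_mul, ← Finset.mul_sum]
      rw [AddChar.sum_apply_eq_ite, Finsupp.single_apply]
      by_cases ham : a = m
      · simp [ham, hcard]
      · simp [ham, ← sub_eq_add_neg, sub_eq_zero]
    rw [h]
    exact sum_mem fun ψ _ => Submodule.smul_mem _ _ (Submodule.subset_span ⟨ψ, rfl⟩)

end Fourier

section RaisingOperators

variable {l n : ℕ} {ε : ℂ}

theorem mval_dlt_of_ne {j k j' k' : ℕ} (h : (j, k) ≠ (j', k')) :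
    mval (dlt j' k' : Mt l n) j k = 0 := by
  simp [mval, dlt, h]

theorem mval_dlt_self {j k : ℕ} (h : 1 ≤ j ∧ j ≤ k ∧ k ≤ n) :
    mval (dlt j k : Mt l n) j k = 1 := by
  simp [mval, dlt, h]

theorem mval_zetaE (i k j t : ℕ) :
    mval (zetaE l n i k) j t = mval (dlt i k : Mt l n) j t + mval (dlt i (k - 1) : Mt l n) j t
      - mval (dlt (i - 1) (k - 1) : Mt l n) j t - mval (dlt (i + 1) k : Mt l n) j t := by
  unfold mval zetaE
  split_ifs <;> simp

variable [NeZero l]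

/-- The character `m ↦ ε ^ m_{jk}`. -/
def entryChar (hε : IsPrimitiveRoot ε l) (j k : ℕ) : AddChar (Mt l n) ℂ where
  toFun m := epow ε (mval m j k)
  map_zero_eq_one' := by simp [mval, epow_zero]
  map_add_eq_mul' a b := by
    rw [← epow_add hε]
    congr 1
    unfold mval
    split_ifs <;> simp

/-- The character `m ↦ ε ^ (m_{ik} + ⋯ + m_{in})`. -/
def rowChar (hε : IsPrimitiveRoot ε l) (i k : ℕ) : AddChar (Mt l n) ℂ :=
  (List.ofFn fun t : Fin (n + 1 - k) => entryChar hε i (k + t)).prod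

theorem XprodE_waveVec (hε : IsPrimitiveRoot ε l) (i k : ℕ) (ψ : AddChar (Mt l n) ℂ) :
    XprodE l n ε i k (waveVec ψ) = waveVec (ψ * (rowChar hε i k)⁻¹) := by
  rw [rowChar, ← list_prod_diagOp_waveVec, List.map_ofFn]
  rfl

theorem braceShift_waveVec (ξ : Mt l n) (ψ : AddChar (Mt l n) ℂ) :
    braceShift l n ε 1 ξ (waveVec ψ) = ((ε - ε⁻¹)⁻¹ * (ψ ξ - (ψ ξ)⁻¹)) • waveVec ψ := by
  simp [braceShift, shiftOp_waveVec, AddChar.map_neg_eq_inv, ← sub_smul, mul_smul]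

theorem rowChar_apply (hε : IsPrimitiveRoot ε l) (i k : ℕ) (m : Mt l n) :
    rowChar hε i k m = ∏ t : Fin (n + 1 - k), epow ε (mval m i (k + t)) := by
  rw [rowChar, List.prod_ofFn, AddChar.prod_apply]
  rfl

theorem rowChar_zetaE_self (hε : IsPrimitiveRoot ε l) (hl : 1 < l) {i k : ℕ} (hi : 1 ≤ i)
    (hik : i ≤ k) (hk : k ≤ n) : rowChar hε i k (zetaE l n i k) = ε := by
  rw [rowChar_apply, Finset.prod_eq_single (⟨0, by omega⟩ : Fin (n + 1 - k))]
  · rw [mval_zetaE, mval_dlt_of_ne (j' := i - 1), mval_dlt_of_ne (j' := i + 1),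
      mval_dlt_of_ne (k' := k - 1)]
    · simp [mval_dlt_self (l := l) ⟨hi, hik, hk⟩, epow_one hl]
    all_goals simp only [ne_eq, Prod.mk.injEq]; omega
  · intro t _ ht
    have ht : (t : ℕ) ≠ 0 := fun h => ht (Fin.ext h)
    rw [mval_zetaE, mval_dlt_of_ne (j' := i - 1), mval_dlt_of_ne (j' := i + 1),
      mval_dlt_of_ne (k' := k - 1), mval_dlt_of_ne (k' := k)]
    · simp [epow_zero]
    all_goals simp only [ne_eq, Prod.mk.injEq]; omega
  · simp

theorem rowChar_zetaE_of_before (hε : IsPrimitiveRoot ε l) {i k i' k' : ℕ} (hi : 1 ≤ i)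
    (hik : i ≤ k) (h : k' < k ∨ k' = k ∧ i < i') : rowChar hε i k (zetaE l n i' k') = 1 := by
  rw [rowChar_apply]
  refine Finset.prod_eq_one fun t _ => ?_
  rw [mval_zetaE, mval_dlt_of_ne, mval_dlt_of_ne, mval_dlt_of_ne, mval_dlt_of_ne]
  · simp [epow_zero]
  all_goals simp only [ne_eq, Prod.mk.injEq]; omega

/-- The `j`-th digit of the height of `ψ`; larger `j` means smaller column, then larger row. -/
def heightDigit (ε : ℂ) (ψ : AddChar (Mt l n) ℂ) (j : ℕ) : ℕ :=
  dlog ε (ψ (zetaE l n (j % (n + 1)) (n - j / (n + 1))))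

/-- A height that strictly decreases along every nonzero term of the raising operators. -/
def height (ε : ℂ) (ψ : AddChar (Mt l n) ℂ) : ℕ :=
  ∑ j ∈ Finset.range ((n + 1) * (n + 1)), heightDigit ε ψ j * l ^ j

theorem height_mul_inv_rowChar_lt (hε : IsPrimitiveRoot ε l) (hl : 1 < l) {i k : ℕ} (hi : 1 ≤ i)
    (hik : i ≤ k) (hk : k ≤ n) {ψ : AddChar (Mt l n) ℂ} (hψ : ψ (zetaE l n i k) ≠ 1) :
    height ε (ψ * (rowChar hε i k)⁻¹) < height ε ψ := by
  have hval : ∀ ξ : Mt l n, (ψ * (rowChar hε i k)⁻¹ : AddChar (Mt l n) ℂ) ξ = ψ ξ * (rowChar hε i k ξ)⁻¹ := fun ξ => by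
    rw [AddChar.mul_apply, AddChar.inv_apply, AddChar.map_neg_eq_inv]
  have hmod : (i + (n + 1) * (n - k)) % (n + 1) = i := by
    rw [Nat.add_mul_mod_self_left, Nat.mod_eq_of_lt (by omega)]
  have hdiv : (i + (n + 1) * (n - k)) / (n + 1) = n - k := by
    rw [Nat.add_mul_div_left _ _ (by omega), Nat.div_eq_of_lt (by omega), zero_add]
  refine sum_digits_lt (P := i + (n + 1) * (n - k))
    (fun j => dlog_lt hε (apply_pow_eq_one _ _)) ?_ ?_ ?_
  · unfold heightDigit
    rw [hmod, hdiv, Nat.sub_sub_self hk, hval, rowChar_zetaE_self hε hl hi hik hk]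
    exact dlog_mul_inv_lt hε (apply_pow_eq_one _ _) hψ
  · intro j hj
    unfold heightDigit
    rw [hval, rowChar_zetaE_of_before hε hi hik, inv_one, mul_one]
    have hle : n - k ≤ j / (n + 1) := hdiv ▸ Nat.div_le_div_right hj.le
    rcases hle.lt_or_eq with hlt | heq
    · left; omega
    · right
      have := Nat.mod_add_div j (n + 1)
      rw [← heq] at this
      omega
  · have : (n + 1) * (n - k) ≤ (n + 1) * n := Nat.mul_le_mul_left _ (by omega)
    rw [mul_add (n + 1) n 1]
    omega

/-- The span of the `waveVec ψ` of height less than `d`. -/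
def heightFiltration (l n : ℕ) [NeZero l] (ε : ℂ) (d : ℕ) : Submodule ℂ (Vsp l n) :=
  Submodule.span ℂ (waveVec '' {ψ | height ε ψ < d})

theorem Esp_mem_heightFiltration (hε : IsPrimitiveRoot ε l) (hl : 1 < l) {i d : ℕ} (hi : 1 ≤ i)
    {v : Vsp l n} (hv : v ∈ heightFiltration l n ε (d + 1)) :
    Esp l n ε i v ∈ heightFiltration l n ε d := by
  suffices heightFiltration l n ε (d + 1) ≤ (heightFiltration l n ε d).comap (Esp l n ε i) from
    this hv
  refine Submodule.span_le.2 ?_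
  rintro _ ⟨ψ, hψ, rfl⟩
  rw [SetLike.mem_coe, Submodule.mem_comap, Esp, LinearMap.sum_apply]
  refine sum_mem fun k hk => ?_
  obtain ⟨hik, hk⟩ := Finset.mem_Icc.1 hk
  rw [Module.End.mul_apply, braceShift_waveVec, map_smul, XprodE_waveVec hε]
  by_cases h : ψ (zetaE l n i k) = 1
  · simp [h]
  · have := height_mul_inv_rowChar_lt hε hl hi hik hk h
    exact Submodule.smul_mem _ _ (Submodule.subset_span
      ⟨_, this.trans_le (Nat.le_of_lt_succ hψ), rfl⟩)

theorem exists_heightFiltration_eq_top (l n : ℕ) [NeZero l] (ε : ℂ) :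
    ∃ d, heightFiltration l n ε d = ⊤ := by
  obtain ⟨d, hd⟩ := (Set.finite_range (height (l := l) (n := n) ε)).bddAbove
  refine ⟨d + 1, ?_⟩
  rw [heightFiltration, ← span_waveVec, ← Set.image_univ]
  congr
  exact Set.eq_univ_of_forall fun ψ => Nat.lt_succ_of_le (hd ⟨ψ, rfl⟩)

end RaisingOperators

theorem invariant_subspace_contains_primitive_vector (l n : ℕ) (hlodd : Odd l) (hl : 1 < l)
    (ε : ℂ) (hε : IsPrimitiveRoot ε l) (hn : 1 ≤ n)
    (W : Submodule ℂ (Vsp l n)) (hW : W ≠ ⊥)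
    (hinv : ∀ i, 1 ≤ i → i ≤ n → ∀ v ∈ W, Esp l n ε i v ∈ W) :
    ∃ v ∈ W, v ≠ 0 ∧ ∀ i, 1 ≤ i → i ≤ n → Esp l n ε i v = 0 := by
  classical
  have : NeZero l := ⟨by omega⟩
  have hex : ∃ d, W ⊓ heightFiltration l n ε d ≠ ⊥ := by
    obtain ⟨d, hd⟩ := exists_heightFiltration_eq_top l n ε
    exact ⟨d, by rwa [hd, inf_top_eq]⟩
  obtain ⟨d, hd⟩ : ∃ d, Nat.find hex = d + 1 := by
    refine Nat.exists_eq_succ_of_ne_zero fun h => Nat.find_spec hex ?_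
    rw [h]
    simp [heightFiltration]
  have hbot : W ⊓ heightFiltration l n ε d = ⊥ := not_not.1 (Nat.find_min hex (by omega))
  obtain ⟨v, ⟨hvW, hvd⟩, hv0⟩ := Submodule.exists_mem_ne_zero_of_ne_bot (hd ▸ Nat.find_spec hex)
  refine ⟨v, hvW, hv0, fun i hi hin => ?_⟩
  rw [← Submodule.mem_bot ℂ, ← hbot]
  exact ⟨hinv i hi hin v hvW, Esp_mem_heightFiltration hε hl hi hvd⟩
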